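/- Let q be a real-valued locally integrable function on ℝ, and let y_0 ∈ ℝ. Suppose the function β = y_0 S_{1,q} + C_{q,1} has no zeros on ℝ. Then y = (y_0 C_{1,q} + S_{q,1}) / (y_0 S_{1,q} + C_{q,1}) is a real-valued locally absolutely continuous function on ℝ satisfying y(0) = y_0 and y² + y′ = q almost everywhere; i.e., y is a pre-image of q under the Miura transform α ↦ α² + α′. -/

import Mathlib

open MeasureTheory intervalIntegral Filter

noncomputable section

/-- Alternating product f(s1)g(s2)f(s3)⋯ with j factors (index 0 ↦ f). -/
def altProd (f g : ℝ → ℂ) (j : ℕ) (s : Fin j → ℝ) : ℂ :=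
  ∏ i : Fin j, if (i : ℕ) % 2 = 0 then f (s i) else g (s i)

/-- The signed simplex integral A_j(f,g,x). -/
def simplexA (f g : ℝ → ℂ) (j : ℕ) (x : ℝ) : ℂ :=
  if 0 ≤ x then
    ∫ s in {s : Fin j → ℝ | StrictMono s ∧ ∀ i, s i ∈ Set.Ioo 0 x}, altProd f g j s
  else
    (-1 : ℂ) ^ j *
      ∫ s in {s : Fin j → ℝ | StrictAnti s ∧ ∀ i, s i ∈ Set.Ioo x 0}, altProd f g j s

/-- The bivariate exponential E_{f,g}. -/
def bivE (f g : ℝ → ℂ) (x : ℝ) : ℂ := 1 + ∑' j : ℕ, simplexA f g (j + 1) x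

def bivC (f g : ℝ → ℂ) (x : ℝ) : ℂ := (bivE f g x + bivE (-f) (-g) x) / 2

def bivS (f g : ℝ → ℂ) (x : ℝ) : ℂ := (bivE f g x - bivE (-f) (-g) x) / 2

/-- Locally absolutely continuous complex-valued function on ℝ. -/
def LocAC (F : ℝ → ℂ) : Prop :=
  ∃ F' : ℝ → ℂ, LocallyIntegrable F' volume ∧
    ∀ x : ℝ, F x = F 0 + ∫ t in (0:ℝ)..x, F' t

end

/-- The `j`-th factor (counted from `0`) of an alternating product. -/
def altFactor (f g : ℝ → ℂ) (j : ℕ) (t : ℝ) : ℂ :=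
  if j % 2 = 0 then f t else g t

theorem altFactor_locallyIntegrable {f g : ℝ → ℂ} (hf : LocallyIntegrable f volume)
    (hg : LocallyIntegrable g volume) (j : ℕ) :
    LocallyIntegrable (altFactor f g j) volume := by
  unfold altFactor
  split_ifs
  exacts [hf, hg]

theorem MeasureTheory.LocallyIntegrable.intervalIntegrable_of_real {E : Type*} [NormedAddCommGroup E]
    {f : ℝ → E} (hf : LocallyIntegrable f volume) (a b : ℝ) :
    IntervalIntegrable f volume a b :=
  intervalIntegrable_iff.mpr <|
    (hf.integrableOn_isCompact isCompact_uIcc).mono_set Set.uIoc_subset_uIcc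

/-- The open ordered simplex in `(0, x)^j`. -/
def orderedSimplex (j : ℕ) (x : ℝ) : Set (Fin j → ℝ) :=
  {s | StrictMono s ∧ ∀ i, s i ∈ Set.Ioo 0 x}

theorem measurableSet_orderedSimplex (j : ℕ) (x : ℝ) :
    MeasurableSet (orderedSimplex j x) := by
  have h : orderedSimplex j x =
      (⋂ a : Fin j, ⋂ b : Fin j, ⋂ _ : a < b, {s : Fin j → ℝ | s a < s b}) ∩
        Set.univ.pi fun _ => Set.Ioo 0 x := by
    ext s
    simp [orderedSimplex, StrictMono, Set.mem_pi]
  rw [h]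
  refine MeasurableSet.inter ?_ (MeasurableSet.univ_pi fun _ => measurableSet_Ioo)
  exact MeasurableSet.iInter fun a => MeasurableSet.iInter fun b => MeasurableSet.iInter fun _ =>
    measurableSet_lt (measurable_pi_apply a) (measurable_pi_apply b)

theorem snoc_mem_orderedSimplex {j : ℕ} {x t : ℝ} {s : Fin j → ℝ} :
    (Fin.snoc s t : Fin (j + 1) → ℝ) ∈ orderedSimplex (j + 1) x ↔
      t ∈ Set.Ioo 0 x ∧ s ∈ orderedSimplex j t := by
  constructor
  · rintro ⟨hm, hI⟩
    refine ⟨by simpa using hI (Fin.last j), fun a b hab => ?_, fun i => ⟨?_, ?_⟩⟩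
    · simpa using hm (Fin.castSucc_lt_castSucc_iff.mpr hab)
    · simpa using (hI i.castSucc).1
    · simpa using hm (Fin.castSucc_lt_last i)
  · rintro ⟨ht, hm, hI⟩
    refine ⟨fun a b hab => ?_, fun i => ?_⟩
    · induction b using Fin.lastCases with
      | last =>
        induction a using Fin.lastCases with
        | last => exact absurd hab (lt_irrefl _)
        | cast a => simpa using (hI a).2
      | cast b =>
        induction a using Fin.lastCases with
        | last => exact absurd hab (not_lt.mpr (Fin.le_last _))
        | cast a => simpa using hm (Fin.castSucc_lt_castSucc_iff.mp hab)
    · induction i using Fin.lastCases with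
      | last => simpa using ht
      | cast i => simpa using ⟨(hI i).1, (hI i).2.trans ht.2⟩

theorem altProd_snoc (f g : ℝ → ℂ) (j : ℕ) (s : Fin j → ℝ) (t : ℝ) :
    altProd f g (j + 1) (Fin.snoc s t) = altFactor f g j t * altProd f g j s := by
  simp [altProd, altFactor, Fin.prod_univ_castSucc, mul_comm]

theorem integrableOn_altProd {f g : ℝ → ℂ} (hf : LocallyIntegrable f volume)
    (hg : LocallyIntegrable g volume) (j : ℕ) (x : ℝ) :
    IntegrableOn (altProd f g j) (orderedSimplex j x) volume := by
  have hbox : IntegrableOn (altProd f g j) (Set.univ.pi fun _ => Set.Ioo 0 x) volume := by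
    rw [IntegrableOn, volume_pi, Measure.restrict_pi_pi]
    refine Integrable.fintype_prod (f := fun i : Fin j => altFactor f g i) fun i => ?_
    exact ((altFactor_locallyIntegrable hf hg i).integrableOn_isCompact
      (isCompact_Icc (a := 0) (b := x))).mono_set Set.Ioo_subset_Icc_self
  exact hbox.mono_set fun s hs i _ => hs.2 i

theorem simplexA_of_nonneg (f g : ℝ → ℂ) (j : ℕ) {x : ℝ} (hx : 0 ≤ x) :
    simplexA f g j x = ∫ s in orderedSimplex j x, altProd f g j s := by
  rw [simplexA, if_pos hx]
  rfl

theorem simplexA_zero (f g : ℝ → ℂ) (x : ℝ) : simplexA f g 0 x = 1 := by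
  have h1 : {s : Fin 0 → ℝ | StrictMono s ∧ ∀ i, s i ∈ Set.Ioo 0 x} = Set.univ := by
    ext s; simp [Subsingleton.strictMono]
  have h2 : {s : Fin 0 → ℝ | StrictAnti s ∧ ∀ i, s i ∈ Set.Ioo x 0} = Set.univ := by
    ext s; simp [Subsingleton.strictAnti]
  simp only [simplexA, h1, h2, altProd]
  simp [measureReal_def, volume_pi]

theorem simplexA_succ_of_nonneg {f g : ℝ → ℂ} (hf : LocallyIntegrable f volume)
    (hg : LocallyIntegrable g volume) (j : ℕ) {x : ℝ} (hx : 0 ≤ x) :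
    simplexA f g (j + 1) x = ∫ t in (0:ℝ)..x, altFactor f g j t * simplexA f g j t := by
  have he := (volume_preserving_piFinSuccAbove (fun _ : Fin (j + 1) => ℝ) (Fin.last j)).symm
  set F : (Fin (j + 1) → ℝ) → ℂ :=
    (orderedSimplex (j + 1) x).indicator (altProd f g (j + 1)) with hF
  have hFi : Integrable F volume :=
    (integrable_indicator_iff (measurableSet_orderedSimplex _ _)).mpr
      (integrableOn_altProd hf hg _ _)
  have hFe : ∀ p : ℝ × (Fin j → ℝ),
      F ((MeasurableEquiv.piFinSuccAbove (fun _ : Fin (j + 1) => ℝ) (Fin.last j)).symm p) =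
        (Set.Ioo 0 x).indicator (fun t => altFactor f g j t *
          (orderedSimplex j t).indicator (altProd f g j) p.2) p.1 := by
    rintro ⟨t, s⟩
    have : (MeasurableEquiv.piFinSuccAbove (fun _ : Fin (j + 1) => ℝ) (Fin.last j)).symm (t, s) =
        Fin.snoc s t := Fin.insertNth_last' t s
    rw [this, hF]
    by_cases ht : t ∈ Set.Ioo 0 x <;> by_cases hs : s ∈ orderedSimplex j t <;>
      simp [Set.indicator, snoc_mem_orderedSimplex, ht, hs, altProd_snoc, -Set.mem_Ioo]
  rw [simplexA_of_nonneg f g _ hx, ← MeasureTheory.integral_indicator (measurableSet_orderedSimplex _ _), ← hF,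
    ← he.integral_comp', Measure.volume_eq_prod, integral_prod]
  · rw [intervalIntegral.integral_of_le hx, integral_Ioc_eq_integral_Ioo,
      ← MeasureTheory.integral_indicator measurableSet_Ioo]
    congr 1 with t
    simp only [hFe]
    by_cases ht : t ∈ Set.Ioo 0 x
    · simp only [Set.indicator_of_mem ht]
      rw [MeasureTheory.integral_const_mul, MeasureTheory.integral_indicator (measurableSet_orderedSimplex _ _),
        simplexA_of_nonneg f g _ ht.1.le]
    · simp [Set.indicator_of_notMem ht]
  · exact (he.integrable_comp_emb (MeasurableEquiv.measurableEmbedding _)).mpr hFi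

theorem simplexA_neg_arg (f g : ℝ → ℂ) (j : ℕ) {x : ℝ} (hx : 0 ≤ x) :
    simplexA f g j (-x) = simplexA (fun t => -f (-t)) (fun t => -g (-t)) j x := by
  rcases hx.eq_or_lt with rfl | hx
  · cases j with
    | zero => simp [simplexA_zero]
    | succ j => simp [simplexA]
  rw [simplexA, if_neg (by linarith), simplexA, if_pos hx.le]
  have hm : MeasurableSet {s : Fin j → ℝ | StrictMono s ∧ ∀ i, s i ∈ Set.Ioo 0 x} :=
    measurableSet_orderedSimplex j x
  have hset : {s : Fin j → ℝ | StrictAnti s ∧ ∀ i, s i ∈ Set.Ioo (-x) 0} =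
      Neg.neg ⁻¹' {s : Fin j → ℝ | StrictMono s ∧ ∀ i, s i ∈ Set.Ioo 0 x} := by
    ext s
    simp only [Set.mem_ofPred_eq, Set.mem_preimage, Set.mem_Ioo, Pi.neg_apply, StrictAnti,
      StrictMono, neg_lt_neg_iff, neg_pos, neg_lt]
    simp only [and_comm]
  rw [hset, ← MeasureTheory.integral_indicator (measurable_neg hm), ← MeasureTheory.integral_indicator hm,
    ← integral_neg_eq_self, ← MeasureTheory.integral_const_mul]
  congr 1 with s
  simp only [Set.indicator, Set.mem_preimage, neg_neg, mul_ite, mul_zero]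
  congr 1
  have hc : (-1 : ℂ) ^ j = ∏ _i : Fin j, (-1 : ℂ) := by simp
  rw [hc, altProd, altProd, ← Finset.prod_mul_distrib]
  refine Finset.prod_congr rfl fun i _ => ?_
  split_ifs <;> simp

theorem simplexA_succ {f g : ℝ → ℂ} (hf : LocallyIntegrable f volume)
    (hg : LocallyIntegrable g volume) (j : ℕ) (x : ℝ) :
    simplexA f g (j + 1) x = ∫ t in (0:ℝ)..x, altFactor f g j t * simplexA f g j t := by
  rcases le_total 0 x with hx | hx
  · exact simplexA_succ_of_nonneg hf hg j hx
  have hneg : ∀ {u : ℝ → ℂ}, LocallyIntegrable u volume →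
      LocallyIntegrable (fun t => -u (-t)) volume := by
    intro u hu
    refine LocallyIntegrable.neg (f := fun t => u (-t)) ?_
    rw [locallyIntegrable_iff] at hu ⊢
    intro k hk
    have := (Measure.measurePreserving_neg (volume : Measure ℝ)).integrableOn_comp_preimage
      (f := u) (s := -k) (Homeomorph.neg ℝ).measurableEmbedding
    have h2 := this.mpr (hu (-k) hk.neg)
    simpa [Function.comp_def] using h2
  obtain ⟨z, rfl⟩ : ∃ z, x = -z := ⟨-x, by simp⟩
  have hz : 0 ≤ z := by linarith
  rw [simplexA_neg_arg f g _ hz, simplexA_succ_of_nonneg (hneg hf) (hneg hg) j hz]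
  have : ∀ t ∈ Set.uIcc 0 z, altFactor (fun t => -f (-t)) (fun t => -g (-t)) j t *
      simplexA (fun t => -f (-t)) (fun t => -g (-t)) j t =
      -(fun t => altFactor f g j t * simplexA f g j t) (-t) := by
    intro t ht
    rw [Set.uIcc_of_le hz] at ht
    simp only [simplexA_neg_arg f g _ ht.1, altFactor]
    split_ifs <;> ring
  rw [intervalIntegral.integral_congr this, intervalIntegral.integral_neg,
    intervalIntegral.integral_comp_neg (fun t => altFactor f g j t * simplexA f g j t),
    intervalIntegral.integral_symm]
  simp

theorem MeasureTheory.LocallyIntegrable.complex_ofReal {f : ℝ → ℝ}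
    (hf : LocallyIntegrable f volume) : LocallyIntegrable (fun t => (f t : ℂ)) volume := by
  rw [locallyIntegrable_iff] at hf ⊢
  exact fun k hk => (hf k hk).ofReal

theorem MeasureTheory.LocallyIntegrable.norm_real {E : Type*} [NormedAddCommGroup E]
    {f : ℝ → E} (hf : LocallyIntegrable f volume) :
    LocallyIntegrable (fun t => ‖f t‖) volume :=
  locallyIntegrableOn_univ.1 (locallyIntegrableOn_univ.2 hf).norm

theorem AbsolutelyContinuousOnInterval.integral_eq_sub_of_ae_hasDerivAt {F h : ℝ → ℝ} {a b : ℝ}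
    (hF : AbsolutelyContinuousOnInterval F a b) (hd : ∀ᵐ x, HasDerivAt F (h x) x) :
    ∫ t in a..b, h t = F b - F a := by
  rw [← hF.integral_deriv_eq_sub]
  refine intervalIntegral.integral_congr_ae ?_
  filter_upwards [hd] with x hx _ using hx.deriv.symm

theorem AbsolutelyContinuousOnInterval.pow_succ {F : ℝ → ℝ} {a b : ℝ}
    (hF : AbsolutelyContinuousOnInterval F a b) (n : ℕ) :
    AbsolutelyContinuousOnInterval (fun t => F t ^ (n + 1)) a b := by
  induction n with
  | zero => simpa using hF
  | succ n ih =>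
    refine (ih.mul hF).congr fun t => ?_
    simp [_root_.pow_succ]

theorem integral_mul_primitive_pow {m : ℝ → ℝ} (hm : LocallyIntegrable m volume) (n : ℕ)
    (x : ℝ) :
    ∫ t in (0:ℝ)..x, m t * ((∫ u in (0:ℝ)..t, m u) ^ n / n.factorial) =
      (∫ u in (0:ℝ)..x, m u) ^ (n + 1) / (n + 1).factorial := by
  have hac := ((hm.intervalIntegrable_of_real 0 x).absolutelyContinuousOnInterval_intervalIntegral
    (c := 0) (by simp)).pow_succ n
  have hd : ∀ᵐ x, HasDerivAt (fun t => (∫ u in (0:ℝ)..t, m u) ^ (n + 1))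
      ((n + 1 : ℕ) * (∫ u in (0:ℝ)..x, m u) ^ n * m x) x := by
    filter_upwards [LocallyIntegrable.ae_hasDerivAt_integral hm] with x hx
    simpa using (hx 0).fun_pow (n + 1)
  have h := hac.integral_eq_sub_of_ae_hasDerivAt hd
  simp only [intervalIntegral.integral_same, ne_eq, Nat.add_eq_zero_iff, one_ne_zero, and_false,
    not_false_eq_true, zero_pow, sub_zero] at h
  rw [← h, ← intervalIntegral.integral_div]
  refine intervalIntegral.integral_congr fun t _ => ?_
  have : (n.factorial : ℝ) ≠ 0 := by positivity
  rw [Nat.factorial_succ]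
  push_cast
  field_simp

theorem continuous_simplexA {f g : ℝ → ℂ} (hf : LocallyIntegrable f volume)
    (hg : LocallyIntegrable g volume) (j : ℕ) : Continuous (simplexA f g j) := by
  induction j with
  | zero => simpa only [funext (simplexA_zero f g)] using continuous_const
  | succ j ih =>
    rw [funext (simplexA_succ hf hg j)]
    exact intervalIntegral.continuous_primitive (fun a b =>
      ((altFactor_locallyIntegrable hf hg j).mul_continuous ih).intervalIntegrable_of_real a b) 0

theorem norm_simplexA_le {f g : ℝ → ℂ} (hf : LocallyIntegrable f volume)
    (hg : LocallyIntegrable g volume) (j : ℕ) (x : ℝ) :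
    ‖simplexA f g j x‖ ≤ |∫ t in (0:ℝ)..x, (‖f t‖ + ‖g t‖)| ^ j / j.factorial := by
  have hm : LocallyIntegrable (fun t => ‖f t‖ + ‖g t‖) volume := hf.norm_real.add hg.norm_real
  have hM : Continuous fun x => ∫ t in (0:ℝ)..x, (‖f t‖ + ‖g t‖) :=
    intervalIntegral.continuous_primitive hm.intervalIntegrable_of_real 0
  induction j generalizing x with
  | zero => simp [simplexA_zero]
  | succ j ih =>
    rw [simplexA_succ hf hg]
    have hle : ∀ t, ‖altFactor f g j t * simplexA f g j t‖ ≤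
        (‖f t‖ + ‖g t‖) * (|∫ u in (0:ℝ)..t, (‖f u‖ + ‖g u‖)| ^ j / j.factorial) := by
      intro t
      rw [norm_mul]
      refine mul_le_mul ?_ (ih t) (norm_nonneg _) (by positivity)
      unfold altFactor
      split_ifs <;> simp
    have hint : LocallyIntegrable (fun t => (‖f t‖ + ‖g t‖) *
        (|∫ u in (0:ℝ)..t, (‖f u‖ + ‖g u‖)| ^ j / j.factorial)) volume :=
      hm.mul_continuous ((hM.abs.pow j).div_const _)
    refine (intervalIntegral.norm_integral_le_abs_of_norm_le (Eventually.of_forall hle)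
      (hint.intervalIntegrable_of_real 0 x)).trans ?_
    have key : ∃ c : ℝ, |c| = 1 ∧ ∀ t ∈ Set.uIcc 0 x,
        |∫ u in (0:ℝ)..t, (‖f u‖ + ‖g u‖)| = c * ∫ u in (0:ℝ)..t, (‖f u‖ + ‖g u‖) := by
      rcases le_total 0 x with hx | hx
      · refine ⟨1, by simp, fun t ht => ?_⟩
        rw [Set.uIcc_of_le hx] at ht
        rw [one_mul, abs_of_nonneg]
        exact intervalIntegral.integral_nonneg ht.1 fun u _ => by positivity
      · refine ⟨-1, by simp, fun t ht => ?_⟩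
        rw [Set.uIcc_of_ge hx] at ht
        rw [intervalIntegral.integral_symm, abs_neg, abs_of_nonneg]
        · ring
        · exact intervalIntegral.integral_nonneg ht.2 fun u _ => by positivity
    obtain ⟨c, hc, hct⟩ := key
    have : Set.EqOn (fun t => (‖f t‖ + ‖g t‖) *
        (|∫ u in (0:ℝ)..t, (‖f u‖ + ‖g u‖)| ^ j / j.factorial))
        (fun t => c ^ j * ((‖f t‖ + ‖g t‖) *
        ((∫ u in (0:ℝ)..t, (‖f u‖ + ‖g u‖)) ^ j / j.factorial))) (Set.uIcc 0 x) := by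
      intro t ht
      simp only [hct t ht]
      ring
    rw [intervalIntegral.integral_congr this, intervalIntegral.integral_const_mul,
      integral_mul_primitive_pow hm, abs_mul, abs_pow, hc, one_pow, one_mul, abs_div, abs_pow,
      Nat.abs_cast]

theorem exists_norm_simplexA_le {f g : ℝ → ℂ} (hf : LocallyIntegrable f volume)
    (hg : LocallyIntegrable g volume) {s : Set ℝ} (hs : IsCompact s) :
    ∃ K : ℝ, ∀ j, ∀ x ∈ s, ‖simplexA f g j x‖ ≤ K ^ j / j.factorial := by
  have hm : LocallyIntegrable (fun t => ‖f t‖ + ‖g t‖) volume := hf.norm_real.add hg.norm_real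
  obtain ⟨K, hK⟩ := hs.exists_bound_of_continuousOn
    (intervalIntegral.continuous_primitive hm.intervalIntegrable_of_real 0).continuousOn
  refine ⟨K, fun j x hx => (norm_simplexA_le hf hg j x).trans ?_⟩
  gcongr
  exact hK x hx

theorem summable_simplexA {f g : ℝ → ℂ} (hf : LocallyIntegrable f volume)
    (hg : LocallyIntegrable g volume) {c : ℕ → ℂ} (hc : ∀ j, ‖c j‖ ≤ 1) (x : ℝ) :
    Summable fun j => c j * simplexA f g j x := by
  refine Summable.of_norm_bounded
    (Real.summable_pow_div_factorial |∫ t in (0:ℝ)..x, (‖f t‖ + ‖g t‖)|) fun j => ?_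
  rw [norm_mul]
  exact (mul_le_of_le_one_left (norm_nonneg _) (hc j)).trans (norm_simplexA_le hf hg j x)

theorem continuous_tsum_simplexA {f g : ℝ → ℂ} (hf : LocallyIntegrable f volume)
    (hg : LocallyIntegrable g volume) {c : ℕ → ℂ} (hc : ∀ j, ‖c j‖ ≤ 1) :
    Continuous fun x => ∑' j, c j * simplexA f g j x := by
  rw [continuous_iff_continuousAt]
  intro x
  obtain ⟨K, hK⟩ := exists_norm_simplexA_le hf hg (isCompact_Icc (a := x - 1) (b := x + 1))
  refine ContinuousOn.continuousAt (s := Set.Icc (x - 1) (x + 1)) ?_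
    (Icc_mem_nhds (by linarith) (by linarith))
  refine continuousOn_tsum
    (fun j => (continuous_const.mul (continuous_simplexA hf hg j)).continuousOn)
    (Real.summable_pow_div_factorial K) fun j t ht => ?_
  rw [norm_mul]
  exact (mul_le_of_le_one_left (norm_nonneg _) (hc j)).trans (hK j t ht)

/-- Termwise integration of the series defining the bivariate exponential. -/
theorem tsum_simplexA_eq_integral {f g p : ℝ → ℂ} (hf : LocallyIntegrable f volume)
    (hg : LocallyIntegrable g volume) (hp : LocallyIntegrable p volume) {c d : ℕ → ℂ}
    (hc : ∀ j, ‖c j‖ ≤ 1) (hd : ∀ j, ‖d j‖ ≤ 1)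
    (hcd : ∀ j t, c (j + 1) * altFactor f g j t = p t * d j) (x : ℝ) :
    ∑' j, c j * simplexA f g j x =
      c 0 + ∫ t in (0:ℝ)..x, p t * ∑' j, d j * simplexA f g j t := by
  rw [(summable_simplexA hf hg hc x).tsum_eq_zero_add, simplexA_zero, mul_one]
  congr 1
  have hterm : ∀ j, c (j + 1) * simplexA f g (j + 1) x =
      ∫ t in (0:ℝ)..x, p t * (d j * simplexA f g j t) := by
    intro j
    rw [simplexA_succ hf hg, ← intervalIntegral.integral_const_mul]
    refine intervalIntegral.integral_congr fun t _ => ?_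
    simp only [← mul_assoc, hcd]
  simp only [hterm]
  obtain ⟨K, hK⟩ := exists_norm_simplexA_le hf hg (isCompact_uIcc (a := 0) (b := x))
  refine (intervalIntegral.hasSum_integral_of_dominated_convergence
    (fun j t => ‖p t‖ * (K ^ j / j.factorial)) (fun j => ?_) (fun j => ?_) ?_ ?_ ?_).tsum_eq
  · exact (hp.mul_continuous (continuous_const.mul
      (continuous_simplexA hf hg j))).aestronglyMeasurable.restrict
  · refine Eventually.of_forall fun t ht => ?_
    rw [norm_mul, norm_mul]
    gcongr
    exact (mul_le_of_le_one_left (norm_nonneg _) (hd j)).trans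
      (hK j t (Set.uIoc_subset_uIcc ht))
  · exact Eventually.of_forall fun t _ => (Real.summable_pow_div_factorial K).mul_left _
  · simp only [tsum_mul_left]
    exact (hp.norm_real.intervalIntegrable_of_real 0 x).mul_const _
  · exact Eventually.of_forall fun t _ => ((summable_simplexA hf hg hd t).hasSum).mul_left _

/-- The indicator of the even numbers. -/
def evenCoeff (j : ℕ) : ℂ := if j % 2 = 0 then 1 else 0

/-- The indicator of the odd numbers. -/
def oddCoeff (j : ℕ) : ℂ := if j % 2 = 0 then 0 else 1

theorem norm_evenCoeff_le (j : ℕ) : ‖evenCoeff j‖ ≤ 1 := by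
  unfold evenCoeff; split_ifs <;> simp

theorem norm_oddCoeff_le (j : ℕ) : ‖oddCoeff j‖ ≤ 1 := by
  unfold oddCoeff; split_ifs <;> simp

theorem simplexA_neg_neg (f g : ℝ → ℂ) (j : ℕ) (x : ℝ) :
    simplexA (-f) (-g) j x = (-1) ^ j * simplexA f g j x := by
  have h : altProd (-f) (-g) j = fun s => (-1) ^ j * altProd f g j s := by
    ext s
    have hc : (-1 : ℂ) ^ j = ∏ _i : Fin j, (-1 : ℂ) := by simp
    rw [hc, altProd, altProd, ← Finset.prod_mul_distrib]
    refine Finset.prod_congr rfl fun i _ => ?_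
    split_ifs <;> simp
  simp only [simplexA, h]
  split_ifs <;> rw [MeasureTheory.integral_const_mul]

theorem bivE_eq_tsum {f g : ℝ → ℂ} (hf : LocallyIntegrable f volume)
    (hg : LocallyIntegrable g volume) (x : ℝ) : bivE f g x = ∑' j, simplexA f g j x := by
  have h := summable_simplexA hf hg (c := fun _ => 1) (by simp) x
  simp only [one_mul] at h
  rw [h.tsum_eq_zero_add, simplexA_zero, bivE]

theorem bivC_eq_tsum {f g : ℝ → ℂ} (hf : LocallyIntegrable f volume)
    (hg : LocallyIntegrable g volume) (x : ℝ) :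
    bivC f g x = ∑' j, evenCoeff j * simplexA f g j x := by
  have h1 := summable_simplexA hf hg (c := fun _ => 1) (by simp) x
  have h2 := summable_simplexA hf hg (c := fun j => (-1) ^ j) (by simp) x
  simp only [one_mul] at h1
  rw [bivC, bivE_eq_tsum hf hg, bivE_eq_tsum hf.neg hg.neg]
  simp only [simplexA_neg_neg]
  rw [← h1.tsum_add h2, ← tsum_div_const]
  refine tsum_congr fun j => ?_
  rcases Nat.even_or_odd j with hj | hj
  · simp [evenCoeff, hj.neg_one_pow, Nat.even_iff.mp hj]
  · simp [evenCoeff, hj.neg_one_pow, Nat.odd_iff.mp hj]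

theorem bivS_eq_tsum {f g : ℝ → ℂ} (hf : LocallyIntegrable f volume)
    (hg : LocallyIntegrable g volume) (x : ℝ) :
    bivS f g x = ∑' j, oddCoeff j * simplexA f g j x := by
  have h1 := summable_simplexA hf hg (c := fun _ => 1) (by simp) x
  have h2 := summable_simplexA hf hg (c := fun j => (-1) ^ j) (by simp) x
  simp only [one_mul] at h1
  rw [bivS, bivE_eq_tsum hf hg, bivE_eq_tsum hf.neg hg.neg]
  simp only [simplexA_neg_neg]
  rw [← h1.tsum_sub h2, ← tsum_div_const]
  refine tsum_congr fun j => ?_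
  rcases Nat.even_or_odd j with hj | hj
  · simp [oddCoeff, hj.neg_one_pow, Nat.even_iff.mp hj]
  · simp [oddCoeff, hj.neg_one_pow, Nat.odd_iff.mp hj]

theorem continuous_bivC {f g : ℝ → ℂ} (hf : LocallyIntegrable f volume)
    (hg : LocallyIntegrable g volume) : Continuous (bivC f g) := by
  rw [funext (bivC_eq_tsum hf hg)]
  exact continuous_tsum_simplexA hf hg norm_evenCoeff_le

theorem continuous_bivS {f g : ℝ → ℂ} (hf : LocallyIntegrable f volume)
    (hg : LocallyIntegrable g volume) : Continuous (bivS f g) := by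
  rw [funext (bivS_eq_tsum hf hg)]
  exact continuous_tsum_simplexA hf hg norm_oddCoeff_le

theorem bivC_eq_integral {f g : ℝ → ℂ} (hf : LocallyIntegrable f volume)
    (hg : LocallyIntegrable g volume) (x : ℝ) :
    bivC f g x = 1 + ∫ t in (0:ℝ)..x, g t * bivS f g t := by
  simp only [bivC_eq_tsum hf hg, bivS_eq_tsum hf hg]
  rw [tsum_simplexA_eq_integral hf hg hg norm_evenCoeff_le norm_oddCoeff_le]
  · simp [evenCoeff]
  · intro j t
    rcases Nat.mod_two_eq_zero_or_one j with hj | hj <;>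
      simp [evenCoeff, oddCoeff, altFactor, Nat.add_mod, hj]

theorem bivS_eq_integral {f g : ℝ → ℂ} (hf : LocallyIntegrable f volume)
    (hg : LocallyIntegrable g volume) (x : ℝ) :
    bivS f g x = ∫ t in (0:ℝ)..x, f t * bivC f g t := by
  simp only [bivC_eq_tsum hf hg, bivS_eq_tsum hf hg]
  rw [tsum_simplexA_eq_integral hf hg hf norm_oddCoeff_le norm_evenCoeff_le]
  · simp [oddCoeff]
  · intro j t
    rcases Nat.mod_two_eq_zero_or_one j with hj | hj <;>
      simp [evenCoeff, oddCoeff, altFactor, Nat.add_mod, hj]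

open ComplexConjugate in
theorem conj_simplexA {f g : ℝ → ℂ} (hf : ∀ t, conj (f t) = f t) (hg : ∀ t, conj (g t) = g t)
    (j : ℕ) (x : ℝ) : conj (simplexA f g j x) = simplexA f g j x := by
  have h : ∀ s, conj (altProd f g j s) = altProd f g j s := by
    intro s
    rw [altProd, map_prod]
    refine Finset.prod_congr rfl fun i _ => ?_
    split_ifs <;> simp [hf, hg]
  unfold simplexA
  split_ifs <;> simp [← integral_conj, h]

open ComplexConjugate in
theorem conj_bivE {f g : ℝ → ℂ} (hf : ∀ t, conj (f t) = f t) (hg : ∀ t, conj (g t) = g t)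
    (x : ℝ) : conj (bivE f g x) = bivE f g x := by
  simp [bivE, Complex.conj_tsum, conj_simplexA hf hg]

open ComplexConjugate in
theorem conj_bivC {f g : ℝ → ℂ} (hf : ∀ t, conj (f t) = f t) (hg : ∀ t, conj (g t) = g t)
    (x : ℝ) : conj (bivC f g x) = bivC f g x := by
  simp [bivC, map_div₀, Complex.conj_ofNat, conj_bivE hf hg, conj_bivE (f := -f) (g := -g) (by simp [hf]) (by simp [hg])]

open ComplexConjugate in
theorem conj_bivS {f g : ℝ → ℂ} (hf : ∀ t, conj (f t) = f t) (hg : ∀ t, conj (g t) = g t)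
    (x : ℝ) : conj (bivS f g x) = bivS f g x := by
  simp [bivS, map_div₀, Complex.conj_ofNat, conj_bivE hf hg, conj_bivE (f := -f) (g := -g) (by simp [hf]) (by simp [hg])]

/-- If `a' = q b` and `b' = a` in integrated form, then `a / b` solves `y' = q - y ^ 2` a.e. -/
theorem ae_hasDerivAt_div_of_system {q a b : ℝ → ℝ} {a₀ b₀ : ℝ}
    (hq : LocallyIntegrable q volume) (hac : Continuous a) (hbc : Continuous b)
    (ha : ∀ x, a x = a₀ + ∫ t in (0:ℝ)..x, q t * b t)
    (hb : ∀ x, b x = b₀ + ∫ t in (0:ℝ)..x, a t) (hb0 : ∀ x, b x ≠ 0) :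
    ∀ᵐ x, HasDerivAt (fun x => a x / b x) (q x - (a x / b x) ^ 2) x := by
  filter_upwards [LocallyIntegrable.ae_hasDerivAt_integral (hq.mul_continuous hbc)] with x hx
  have hda : HasDerivAt a (q x * b x) x := by
    rw [funext ha]
    exact (hx 0).const_add a₀
  have hdb : HasDerivAt b (a x) x := by
    rw [funext hb]
    exact (hac.integral_hasStrictDerivAt 0 x).hasDerivAt.const_add b₀
  refine (hda.fun_div hdb (hb0 x)).congr_deriv ?_
  have := hb0 x
  field_simp

theorem absolutelyContinuousOnInterval_div_of_system {q a b : ℝ → ℝ} {a₀ b₀ : ℝ}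
    (hq : LocallyIntegrable q volume) (hac : Continuous a) (hbc : Continuous b)
    (ha : ∀ x, a x = a₀ + ∫ t in (0:ℝ)..x, q t * b t)
    (hb : ∀ x, b x = b₀ + ∫ t in (0:ℝ)..x, a t) (hb0 : ∀ x, b x ≠ 0) (x : ℝ) :
    AbsolutelyContinuousOnInterval (fun x => a x / b x) 0 x := by
  have hdb : ∀ x, HasDerivAt b (a x) x := fun x => by
    rw [funext hb]
    exact (hac.integral_hasStrictDerivAt 0 x).hasDerivAt.const_add b₀
  have hb1 : ContDiff ℝ 1 b := by
    rw [contDiff_one_iff_deriv]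
    refine ⟨fun x => (hdb x).differentiableAt, ?_⟩
    rwa [funext fun x => (hdb x).deriv]
  have hinv : AbsolutelyContinuousOnInterval (fun x => (b x)⁻¹) 0 x :=
    (hb1.inv hb0).contDiffOn.absolutelyContinuousOnInterval
  have hconst : AbsolutelyContinuousOnInterval (fun _ : ℝ => a₀) 0 x :=
    contDiff_const.contDiffOn.absolutelyContinuousOnInterval
  have haac : AbsolutelyContinuousOnInterval a 0 x := by
    rw [funext ha]
    exact hconst.add (((hq.mul_continuous hbc).intervalIntegrable_of_real 0
      x).absolutelyContinuousOnInterval_intervalIntegral (by simp))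
  simpa only [div_eq_mul_inv] using haac.fun_mul hinv

theorem miura_preimage (q : ℝ → ℝ) (hq : LocallyIntegrable q volume)
    (qc one : ℝ → ℂ) (hqc : qc = fun x => (q x : ℂ)) (hone : one = fun _ => 1)
    (y₀ : ℝ)
    (hβ : ∀ x : ℝ, (y₀ : ℂ) * bivS one qc x + bivC qc one x ≠ 0)
    (y : ℝ → ℂ)
    (hy : y = fun x => ((y₀ : ℂ) * bivC one qc x + bivS qc one x) /
      ((y₀ : ℂ) * bivS one qc x + bivC qc one x)) :
    (∀ x : ℝ, (y x).im = 0) ∧ LocAC y ∧ y 0 = (y₀ : ℂ) ∧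
    (∀ᵐ x : ℝ, ∃ D : ℂ, HasDerivAt y D x ∧ y x ^ 2 + D = (q x : ℂ)) := by
  have hqcL : LocallyIntegrable qc volume := by
    rw [hqc]
    exact hq.complex_ofReal
  have honeL : LocallyIntegrable one volume := by
    rw [hone]
    exact locallyIntegrable_const 1
  have hqr : ∀ t, (starRingEnd ℂ) (qc t) = qc t := by simp [hqc]
  have honer : ∀ t, (starRingEnd ℂ) (one t) = one t := by simp [hone]
  set α : ℝ → ℂ := fun x => (y₀ : ℂ) * bivC one qc x + bivS qc one x with hα
  set β : ℝ → ℂ := fun x => (y₀ : ℂ) * bivS one qc x + bivC qc one x with hβdef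
  have hαc : Continuous α :=
    (continuous_const.mul (continuous_bivC honeL hqcL)).add (continuous_bivS hqcL honeL)
  have hβc : Continuous β :=
    (continuous_const.mul (continuous_bivS honeL hqcL)).add (continuous_bivC hqcL honeL)
  have hαr : ∀ x, ((α x).re : ℂ) = α x := fun x => Complex.conj_eq_iff_re.mp <| by
    simp [hα, conj_bivC honer hqr, conj_bivS hqr honer]
  have hβr : ∀ x, ((β x).re : ℂ) = β x := fun x => Complex.conj_eq_iff_re.mp <| by
    simp [hβdef, conj_bivC hqr honer, conj_bivS honer hqr]
  have hαi : ∀ x, α x = y₀ + ∫ t in (0:ℝ)..x, qc t * β t := by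
    intro x
    have h1 := (hqcL.mul_continuous (continuous_bivS honeL hqcL)).intervalIntegrable_of_real 0 x
    have h2 := (hqcL.mul_continuous (continuous_bivC hqcL honeL)).intervalIntegrable_of_real 0 x
    simp only [hα, hβdef, mul_add, mul_left_comm (qc _)]
    rw [intervalIntegral.integral_add (h1.const_mul _) h2, intervalIntegral.integral_const_mul,
      bivC_eq_integral honeL hqcL, bivS_eq_integral hqcL honeL]
    ring
  have hβi : ∀ x, β x = 1 + ∫ t in (0:ℝ)..x, α t := by
    intro x
    have h1 := (continuous_bivC honeL hqcL).intervalIntegrable (μ := volume) 0 x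
    have h2 := (continuous_bivS hqcL honeL).intervalIntegrable (μ := volume) 0 x
    simp only [hα, hβdef]
    rw [intervalIntegral.integral_add (h1.const_mul _) h2, intervalIntegral.integral_const_mul,
      bivC_eq_integral hqcL honeL, bivS_eq_integral honeL hqcL]
    simp only [hone, one_mul]
    ring
  have hac : Continuous fun x => (α x).re := Complex.continuous_re.comp hαc
  have hbc : Continuous fun x => (β x).re := Complex.continuous_re.comp hβc
  have ha : ∀ x, (α x).re = y₀ + ∫ t in (0:ℝ)..x, q t * (β t).re := by
    intro x
    apply Complex.ofReal_injective
    rw [hαr, hαi, Complex.ofReal_add, ← intervalIntegral.integral_ofReal]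
    simp [hβr, hqc]
  have hb : ∀ x, (β x).re = 1 + ∫ t in (0:ℝ)..x, (α t).re := by
    intro x
    apply Complex.ofReal_injective
    rw [hβr, hβi, Complex.ofReal_add, ← intervalIntegral.integral_ofReal]
    simp [hαr]
  have hb0 : ∀ x, (β x).re ≠ 0 := fun x h => hβ x <| by
    have := hβr x
    rw [h] at this
    exact this.symm
  set Y : ℝ → ℝ := fun x => (α x).re / (β x).re with hY
  have hyY : y = fun x => (Y x : ℂ) := by
    ext x
    simp only [hy, hY, Complex.ofReal_div, hαr, hβr]
    rfl
  have hYc : Continuous Y := hac.div hbc hb0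
  have hYd := ae_hasDerivAt_div_of_system hq hac hbc ha hb hb0
  have hYac := absolutelyContinuousOnInterval_div_of_system hq hac hbc ha hb hb0
  have hL : LocallyIntegrable (fun x => q x - Y x ^ 2) volume :=
    hq.sub (hYc.pow 2).locallyIntegrable
  refine ⟨fun x => by simp [hyY], ⟨fun x => ((q x - Y x ^ 2 : ℝ) : ℂ),
    hL.complex_ofReal, fun x => ?_⟩, ?_, ?_⟩
  · rw [intervalIntegral.integral_ofReal, (hYac x).integral_eq_sub_of_ae_hasDerivAt hYd, hyY]
    push_cast
    simp [hY]
  · simp [hyY, hY, ha 0, hb 0]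
  · filter_upwards [hYd] with x hx
    refine ⟨((q x - Y x ^ 2 : ℝ) : ℂ), ?_, ?_⟩
    · rw [hyY]
      exact hx.ofReal_comp
    · rw [hyY]
      push_cast
      ring
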